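/- In the exterior algebra over ℤ/2ℤ of the module (Fin 8 → ZMod 2), with x₁,y₁,…,x₄,y₄ the images of the standard basis vectors, ωᵢ = xᵢ·yᵢ: for all a, m₂, m₃ ∈ ZMod 2 the element ω₁·ω₂·ω₃ + a·(ω₁·(ω₂+ω₃)·ω₄ + (x₁·y₃ + x₃·y₁)·ω₂·ω₄) + m₂·(ω₁·ω₃·ω₄ + ω₂·ω₃·ω₄ + (x₁·y₃ + x₃·y₁)·ω₂·ω₄) + m₃·(ω₁·ω₂·ω₃ + ω₁·ω₂·ω₄ + ω₁·ω₃·ω₄ + ω₂·ω₃·ω₄) is nonzero. -/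

import Mathlib

noncomputable section

open ExteriorAlgebra

/-- The image of the `i`-th standard basis vector of `(Fin 8 → ZMod 2)` in the
exterior algebra over `ℤ/2ℤ`. -/
def e (i : Fin 8) : ExteriorAlgebra (ZMod 2) (Fin 8 → ZMod 2) :=
  ι (ZMod 2) (Pi.single i 1 : Fin 8 → ZMod 2)

def x₁ : ExteriorAlgebra (ZMod 2) (Fin 8 → ZMod 2) := e 0
def y₁ : ExteriorAlgebra (ZMod 2) (Fin 8 → ZMod 2) := e 1
def x₂ : ExteriorAlgebra (ZMod 2) (Fin 8 → ZMod 2) := e 2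
def y₂ : ExteriorAlgebra (ZMod 2) (Fin 8 → ZMod 2) := e 3
def x₃ : ExteriorAlgebra (ZMod 2) (Fin 8 → ZMod 2) := e 4
def y₃ : ExteriorAlgebra (ZMod 2) (Fin 8 → ZMod 2) := e 5
def x₄ : ExteriorAlgebra (ZMod 2) (Fin 8 → ZMod 2) := e 6
def y₄ : ExteriorAlgebra (ZMod 2) (Fin 8 → ZMod 2) := e 7

def ω₁ : ExteriorAlgebra (ZMod 2) (Fin 8 → ZMod 2) := x₁ * y₁
def ω₂ : ExteriorAlgebra (ZMod 2) (Fin 8 → ZMod 2) := x₂ * y₂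
def ω₃ : ExteriorAlgebra (ZMod 2) (Fin 8 → ZMod 2) := x₃ * y₃
def ω₄ : ExteriorAlgebra (ZMod 2) (Fin 8 → ZMod 2) := x₄ * y₄

/-- Over a ring of characteristic two, the exterior algebra is commutative. -/
theorem ExteriorAlgebra.mul_comm_of_charP_two {R M : Type*} [CommRing R] [CharP R 2]
    [AddCommGroup M] [Module R M] (u v : ExteriorAlgebra R M) : u * v = v * u := by
  have hι (a b : M) : Commute (ι R a) (ι R b) := by
    have hneg : ι R b * ι R a = -(ι R b * ι R a) := by
      rw [← neg_one_smul R, CharTwo.neg_eq, one_smul]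
    exact (eq_neg_of_add_eq_zero_left (ι_add_mul_swap a b)).trans hneg.symm
  have hv (a : M) : Commute (ι R a) v := by
    induction v using ExteriorAlgebra.induction with
    | algebraMap r => exact (Algebra.commutes r _).symm
    | ι b => exact hι a b
    | mul p q hp hq => exact hp.mul_right hq
    | add p q hp hq => exact hp.add_right hq
  change Commute u v
  induction u using ExteriorAlgebra.induction with
  | algebraMap r => exact Algebra.commutes r v
  | ι a => exact hv a
  | mul p q hp hq => exact hp.mul_left hq
  | add p q hp hq => exact hp.add_left hq

/-- The product of the images of a finite basis in the exterior algebra is nonzero. -/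
theorem ExteriorAlgebra.ιMulti_basis_ne_zero {R M : Type*} [CommRing R] [Nontrivial R]
    [AddCommGroup M] [Module R M] {n : ℕ} (b : Module.Basis (Fin n) R M) :
    ιMulti R n b ≠ 0 := by
  intro h
  have hdet := liftAlternating_apply_ιMulti (Pi.single n b.det) b
  rw [h, map_zero, Pi.single_eq_same, b.det_self] at hdet
  exact zero_ne_one hdet

/-- The product `ω₁ω₂ω₃ω₄` is the top form on the standard basis, hence nonzero. -/
theorem omega_prod_ne_zero : ω₁ * ω₂ * ω₃ * ω₄ ≠ 0 := by
  have h := ExteriorAlgebra.ιMulti_basis_ne_zero (Pi.basisFun (ZMod 2) (Fin 8))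
  simpa [ιMulti_apply, List.ofFn_succ, Matrix.vecTail, mul_assoc, ω₁, ω₂, ω₃, ω₄, x₁, y₁, x₂, y₂, x₃, y₃,
    x₄, y₄, e] using h

theorem stmt_13 (a m₂ m₃ : ZMod 2) :
    ω₁ * ω₂ * ω₃
      + a • (ω₁ * (ω₂ + ω₃) * ω₄ + (x₁ * y₃ + x₃ * y₁) * ω₂ * ω₄)
      + m₂ • (ω₁ * ω₃ * ω₄ + ω₂ * ω₃ * ω₄ + (x₁ * y₃ + x₃ * y₁) * ω₂ * ω₄)
      + m₃ • (ω₁ * ω₂ * ω₃ + ω₁ * ω₂ * ω₄ + ω₁ * ω₃ * ω₄ + ω₂ * ω₃ * ω₄) ≠ 0 := by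
  let _ : CommRing (ExteriorAlgebra (ZMod 2) (Fin 8 → ZMod 2)) :=
    { (inferInstance : Ring (ExteriorAlgebra (ZMod 2) (Fin 8 → ZMod 2))) with
      mul_comm := ExteriorAlgebra.mul_comm_of_charP_two }
  have two_eq_zero : (2 : ExteriorAlgebra (ZMod 2) (Fin 8 → ZMod 2)) = 0 := by
    have h := map_ofNat (algebraMap (ZMod 2) (ExteriorAlgebra (ZMod 2) (Fin 8 → ZMod 2))) 2
    rw [← h, show (OfNat.ofNat 2 : ZMod 2) = 0 from rfl, map_zero]
  have sq (i : Fin 8) : e i * e i = 0 := ι_sq_zero _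
  intro h
  apply omega_prod_ne_zero
  simp only [Algebra.smul_def] at h
  -- Multiplying by `ω₁ + ω₂ + ω₃ + ω₄` adds up the coefficients of the four `ωᵢωⱼωₖ`.
  have key := congrArg (· * (ω₁ + ω₂ + ω₃ + ω₄)) h
  have hx₁ : x₁ * x₁ = 0 := sq 0
  have hy₁ : y₁ * y₁ = 0 := sq 1
  have hx₂ : x₂ * x₂ = 0 := sq 2
  have hx₃ : x₃ * x₃ = 0 := sq 4
  have hy₃ : y₃ * y₃ = 0 := sq 5
  have hx₄ : x₄ * x₄ = 0 := sq 6
  simp only [ω₁, ω₂, ω₃, ω₄] at key ⊢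
  grind

end
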